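/- arXiv:1308.0180 — 2 statements merged into one kernel-verified Lean document; each statement's English description precedes it below -/
import Mathlib

section
/- If a digraph H contains a circular N, then H admits no Hagemann–Mitschke chain of polymorphisms of any finite length. -/
namespace DigraphListHom

variable {V W : Type*}

/-- One step of a walk: forward if `dir = true`, backward otherwise. -/
def Step (H : V → V → Prop) (u v : V) (dir : Bool) : Prop :=
  if dir then H u v else H v u

/-- `x` is a walk in `H` with direction pattern `d`. -/
def IsWalk (H : V → V → Prop) {n : ℕ} (d : Fin n → Bool) (x : Fin (n + 1) → V) : Prop :=
  ∀ i : Fin n, Step H (x i.castSucc) (x i.succ) (d i)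

/-- `x_i y_{i+1}` is a faithful edge from `X` to `Y` at position `i`. -/
def FaithfulAt (H : V → V → Prop) {n : ℕ} (d : Fin n → Bool) (x y : Fin (n + 1) → V)
    (i : Fin n) : Prop :=
  Step H (x i.castSucc) (y i.succ) (d i)

/-- `X` avoids `Y`: there is no faithful edge from `X` to `Y`. -/
def Avoids (H : V → V → Prop) {n : ℕ} (d : Fin n → Bool) (x y : Fin (n + 1) → V) : Prop :=
  ∀ i, ¬ FaithfulAt H d x y i

/-- `Z` protects `Y` from `X`: faithful edges `x_i z_{i+1}` and `z_j y_{j+1}` imply `j ≤ i`. -/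
def Protects (H : V → V → Prop) {n : ℕ} (d : Fin n → Bool) (x y z : Fin (n + 1) → V) : Prop :=
  ∀ i j : Fin n, FaithfulAt H d x z i → FaithfulAt H d z y j → (j : ℕ) ≤ (i : ℕ)

/-- `H` contains a circular `N`: congruent walks `X` from `x` to `x`, `Y` from `y` to `y`,
`Z` from `y` to `x`, with `X` avoiding `Y` and `Z` protecting `Y` from `X`. -/
def CircularN (H : V → V → Prop) : Prop :=
  ∃ n : ℕ, 0 < n ∧ ∃ (d : Fin n → Bool) (x y z : Fin (n + 1) → V),
    IsWalk H d x ∧ IsWalk H d y ∧ IsWalk H d z ∧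
    x (Fin.last n) = x 0 ∧ y (Fin.last n) = y 0 ∧
    z 0 = y 0 ∧ z (Fin.last n) = x 0 ∧
    Avoids H d x y ∧ Protects H d x y z

/-- Arc relation of the pair digraph `H⁺` (on ambient pairs). -/
def PairArc (H : V → V → Prop) (p q : V × V) : Prop :=
  (H p.1 q.1 ∧ H p.2 q.2 ∧ ¬ H p.1 q.2) ∨ (H q.1 p.1 ∧ H q.2 p.2 ∧ ¬ H q.2 p.1)

/-- Arc relation of `H⁺` restricted to genuine vertices (pairs of distinct vertices). -/
def PairArcD (H : V → V → Prop) (p q : V × V) : Prop :=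
  p.1 ≠ p.2 ∧ q.1 ≠ q.2 ∧ PairArc H p q

/-- Reachability in `H⁺`. -/
def PairReach (H : V → V → Prop) : V × V → V × V → Prop :=
  Relation.ReflTransGen (PairArcD H)

/-- Mutual reachability in `H⁺` (same strong component). -/
def SameSCC (H : V → V → Prop) (p q : V × V) : Prop :=
  PairReach H p q ∧ PairReach H q p

/-- `C` is a strong component of the digraph with arc relation `R`. -/
def IsStrongComponent {α : Type*} (R : α → α → Prop) (C : Set α) : Prop :=
  ∃ a, C = {b | Relation.ReflTransGen R a b ∧ Relation.ReflTransGen R b a}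

/-- There is a directed path with `m` vertices in the condensation of `H⁺`
ending at the strong component of `p`. -/
def CondChain (H : V → V → Prop) (p : V × V) (m : ℕ) : Prop :=
  ∃ r : Fin m → V × V,
    (∀ i, (r i).1 ≠ (r i).2) ∧
    (∀ i j : Fin m, i < j → PairReach H (r i) (r j) ∧ ¬ PairReach H (r j) (r i)) ∧
    (∀ i, PairReach H (r i) p) ∧
    (∀ h : 0 < m, PairReach H p (r ⟨m - 1, Nat.sub_lt h Nat.one_pos⟩))

/-- `μ(p)`: the maximum number of vertices of a directed path in the condensation of `H⁺`
ending at the strong component of `p` (with `μ(x,x) = 0`). -/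
noncomputable def mu (H : V → V → Prop) (p : V × V) : ℕ :=
  sSup {m | CondChain H p m}

/-- The unordered pair `{u, v}` is `k`-allowed with respect to the ordering `ord` of `V(H⁺)`:
neither `(u,v)` nor `(v,u)` is `k`-processed (i.e. has position `> k`). -/
def KAllowed (ord : V × V → ℕ) (k : ℕ) (u v : V) : Prop :=
  u = v ∨ (ord (u, v) ≤ k ∧ ord (v, u) ≤ k)

/-- `ord` is an ordering of the vertices of `H⁺` listing the strong components
consecutively, in an order in which each component is a sink among the later ones. -/
def GoodOrd (H : V → V → Prop) (ord : V × V → ℕ) : Prop :=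
  (∀ p q : V × V, p.1 ≠ p.2 → q.1 ≠ q.2 → ord p = ord q → p = q) ∧
  (∀ p q : V × V, p.1 ≠ p.2 → q.1 ≠ q.2 → PairReach H p q → ¬ PairReach H q p →
    ord p < ord q) ∧
  (∀ p q r : V × V, p.1 ≠ p.2 → q.1 ≠ q.2 → r.1 ≠ r.2 →
    SameSCC H p q → ord p ≤ ord r → ord r ≤ ord q → SameSCC H p r)

/-- `f` is an `L`-homomorphism of `G` to `H`. -/
def IsLHom (H : V → V → Prop) (G : W → W → Prop) (L : W → Set V) (f : W → V) : Prop :=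
  (∀ u v, G u v → H (f u) (f v)) ∧ ∀ w, f w ∈ L w

/-- Arc relation of the triple digraph `Tr(G,L)`. -/
def TrArc (H : V → V → Prop) (G : W → W → Prop) (L : W → Set V)
    (p q : W × V × V) : Prop :=
  p.2.1 ∈ L p.1 ∧ p.2.2 ∈ L p.1 ∧ q.2.1 ∈ L q.1 ∧ q.2.2 ∈ L q.1 ∧
  G p.1 q.1 ∧ H p.2.1 q.2.1 ∧ H p.2.2 q.2.2 ∧ ¬ H p.2.1 q.2.2 ∧ ¬ H p.2.2 q.2.1

/-- Symmetrization of the triple-digraph arc relation (for weak connectivity). -/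
def TrSym (H : V → V → Prop) (G : W → W → Prop) (L : W → Set V)
    (p q : W × V × V) : Prop :=
  TrArc H G L p q ∨ TrArc H G L q p

/-- Weak connectivity in the triple digraph `Tr(G,L)`. -/
def WConn (H : V → V → Prop) (G : W → W → Prop) (L : W → Set V) :
    W × V × V → W × V × V → Prop :=
  Relation.ReflTransGen (TrSym H G L)

/-- `f` is a ternary polymorphism of `H`. -/
def Polymorphism3 (H : V → V → Prop) (f : V → V → V → V) : Prop :=
  ∀ a a' b b' c c', H a a' → H b b' → H c c' → H (f a b c) (f a' b' c')

/-- `f` is conservative. -/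
def Conservative3 (f : V → V → V → V) : Prop :=
  ∀ a b c, f a b c = a ∨ f a b c = b ∨ f a b c = c

/-- `f 1, …, f k` satisfy the Hagemann–Mitschke identities. -/
def HMChain (f : ℕ → V → V → V → V) (k : ℕ) : Prop :=
  (∀ x y, f 1 x y y = x) ∧
  (∀ i, 1 ≤ i → i < k → ∀ x y, f i x x y = f (i + 1) x y y) ∧
  (∀ x y, f k x x y = y)

/-- `H` contains a pair of independent edges. -/
def IndependentEdges (H : V → V → Prop) : Prop :=
  ∃ a b c d, H a b ∧ H c d ∧ ¬ H a d ∧ ¬ H c b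

/-- `H` contains a bicycle. -/
def Bicycle (H : V → V → Prop) : Prop :=
  ∃ n : ℕ, 0 < n ∧ ∃ x y : Fin (n + 1) → V,
    x (Fin.last n) = x 0 ∧ y (Fin.last n) = y 0 ∧
    ∀ i : Fin n, H (x i.castSucc) (x i.succ) ∧ H (y i.castSucc) (y i.succ) ∧
      ¬ H (x i.castSucc) (y i.succ) ∧ H (y i.castSucc) (x i.succ)

/-- `a` is an `i`-distinguisher of `a, b, c`. -/
def IDist (H : V → V → Prop) (i : ℕ) (a b c : V) : Prop :=
  ∃ (n : ℕ) (d : Fin n → Bool) (X Y Z : Fin (n + 1) → V),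
    IsWalk H d X ∧ IsWalk H d Y ∧ IsWalk H d Z ∧
    X 0 = a ∧ Y 0 = b ∧ Z 0 = c ∧
    Y (Fin.last n) = Z (Fin.last n) ∧
    i ≤ mu H (X (Fin.last n), Y (Fin.last n)) ∧
    Avoids H d Y X ∧ Avoids H d Z X

theorem circularN_step (H : V → V → Prop) {n : ℕ} (d : Fin n → Bool) (x y z : Fin (n + 1) → V)
    (hx : IsWalk H d x) (hy : IsWalk H d y) (hz : IsWalk H d z)
    (hav : Avoids H d x y) (hpr : Protects H d x y z)
    (g : V → V → V → V) (hg : Polymorphism3 H g) (hc : Conservative3 g)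
    (h0 : g (x 0) (z 0) (y 0) = x 0) (t : Fin (n + 1)) :
    g (x t) (z t) (y t) = x t ∨
      (g (x t) (z t) (y t) = z t ∧ ∃ i : Fin n, (i : ℕ) < t ∧ FaithfulAt H d x z i) := by
  induction t using Fin.induction with
  | zero => exact Or.inl h0
  | succ t ih =>
    have hs : Step H (g (x t.castSucc) (z t.castSucc) (y t.castSucc))
        (g (x t.succ) (z t.succ) (y t.succ)) (d t) := by
      have h1 := hx t
      have h2 := hy t
      have h3 := hz t
      unfold Step at *
      split_ifs at * <;> exact hg _ _ _ _ _ _ h1 h3 h2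
    rcases ih with e | ⟨e, i, hi, hf⟩
    · rw [e] at hs
      rcases hc (x t.succ) (z t.succ) (y t.succ) with e' | e' | e'
      · exact Or.inl e'
      · rw [e'] at hs
        exact Or.inr ⟨e', t, by simp, hs⟩
      · rw [e'] at hs
        exact absurd hs (hav t)
    · rw [e] at hs
      rcases hc (x t.succ) (z t.succ) (y t.succ) with e' | e' | e'
      · exact Or.inl e'
      · refine Or.inr ⟨e', i, ?_, hf⟩
        simp at hi ⊢
        omega
      · rw [e'] at hs
        have := hpr i t hf hs
        simp at hi
        omega

/-- a circular `N` forbids any finite HM-chain of (conservative) polymorphisms. -/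
theorem statement8 (H : V → V → Prop) (hH : CircularN H) :
    ¬ ∃ (k : ℕ) (f : ℕ → V → V → V → V), 1 ≤ k ∧ HMChain f k ∧
        ∀ i, 1 ≤ i → i ≤ k → Polymorphism3 H (f i) ∧ Conservative3 (f i) := by
  rintro ⟨k, f, hk, ⟨hm1, hm2, hm3⟩, hf⟩
  obtain ⟨n, hn, d, x, y, z, hx, hy, hz, xl, yl, z0, zl, hav, hpr⟩ := hH
  have key : ∀ i, 1 ≤ i → i ≤ k → f i (x 0) (y 0) (y 0) = x 0 →
      f i (x 0) (x 0) (y 0) = x 0 := by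
    intro i h1 h2 h
    have := circularN_step H d x y z hx hy hz hav hpr (f i) (hf i h1 h2).1 (hf i h1 h2).2
      (by rw [z0]; exact h) (Fin.last n)
    rw [xl, yl, zl] at this
    rcases this with e | e
    · exact e
    · exact e.1
  have all : ∀ i, 1 ≤ i → i ≤ k → f i (x 0) (x 0) (y 0) = x 0 := by
    intro i h1
    induction i, h1 using Nat.le_induction with
    | base => exact fun h => key 1 le_rfl h (hm1 _ _)
    | succ i h1 ih =>
      intro h
      refine key (i + 1) (by omega) h ?_
      rw [← hm2 i h1 (by omega)]
      exact ih (by omega)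
  have hxy : y 0 = x 0 := (hm3 (x 0) (y 0)).symm.trans (all k hk le_rfl)
  have hw := hy ⟨0, hn⟩
  have h0 : Fin.castSucc (⟨0, hn⟩ : Fin n) = 0 := rfl
  refine hav ⟨0, hn⟩ ?_
  unfold FaithfulAt
  rw [h0] at hw ⊢
  rw [← hxy]
  exact hw

end DigraphListHom
end

section
/- Let H be a digraph with no circular N, and let k be the maximum number of vertices on a directed path in the condensation C(H⁺) of the pair digraph H⁺. Then H admits a Hagemann–Mitschke chain of polymorphisms of length k. -/
namespace DigraphListHom

variable {V W : Type*}

/-- One step of a walk of pairs in which the first coordinate avoids the second. -/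
def PStep (H : V → V → Prop) (p q : V × V) (d : Bool) : Prop :=
  Step H p.1 q.1 d ∧ Step H p.2 q.2 d ∧ ¬ Step H p.1 q.2 d

lemma step_not {H : V → V → Prop} {u v : V} {d : Bool} :
    Step H u v (!d) ↔ Step H v u d := by
  cases d <;> simp [Step]

lemma pairArcD_iff {H : V → V → Prop} {p q : V × V} :
    PairArcD H p q ↔ ∃ d, PStep H p q d := by
  constructor
  · rintro ⟨-, -, h | h⟩
    · exact ⟨true, by simpa [PStep, Step] using h⟩
    · exact ⟨false, by simpa [PStep, Step] using h⟩
  · rintro ⟨d, h1, h2, h3⟩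
    refine ⟨fun h => h3 (h ▸ h2), fun h => h3 (h ▸ h1), ?_⟩
    cases d
    · right; simpa [Step] using And.intro h1 (And.intro h2 h3)
    · left; simpa [Step] using And.intro h1 (And.intro h2 h3)

lemma PStep.reach {H : V → V → Prop} {p q : V × V} {d : Bool} (h : PStep H p q d) :
    PairReach H p q :=
  Relation.ReflTransGen.single (pairArcD_iff.2 ⟨d, h⟩)

/-- States `((x, m, z), phase)` for building a circular `N`. -/
def NRel (H : V → V → Prop) (s t : (V × V × V) × Bool) : Prop :=
  ∃ d, Step H s.1.1 t.1.1 d ∧ Step H s.1.2.1 t.1.2.1 d ∧ Step H s.1.2.2 t.1.2.2 d ∧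
    ¬ Step H s.1.1 t.1.2.2 d ∧
    (s.2 = true → ¬ Step H s.1.2.1 t.1.2.2 d) ∧
    (Step H s.1.1 t.1.2.1 d → t.2 = true) ∧ (s.2 = true → t.2 = true)

lemma exists_seq {α : Type*} {R : α → α → Prop} {a b : α} (h : Relation.ReflTransGen R a b) :
    ∃ (n : ℕ) (w : ℕ → α), w 0 = a ∧ w n = b ∧ ∀ j < n, R (w j) (w (j + 1)) := by
  induction h using Relation.ReflTransGen.head_induction_on with
  | refl => exact ⟨0, fun _ => b, rfl, rfl, by simp⟩
  | head h1 _ ih =>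
    rename_i a' c _
    obtain ⟨n, w, h0, hn, hw⟩ := ih
    refine ⟨n + 1, fun j => Nat.casesOn j a' w, rfl, hn, ?_⟩
    intro j hj
    cases j with
    | zero => simpa [h0] using h1
    | succ j => exact hw j (by omega)

lemma circularN_of {H : V → V → Prop} {x y : V} (_hxy : x ≠ y)
    (h : Relation.ReflTransGen (NRel H) ((x, y, y), false) ((x, x, y), true)) :
    CircularN H := by
  obtain ⟨n, w, h0, hn, hw⟩ := exists_seq h
  have hph : ∀ j l, j ≤ l → l ≤ n → (w j).2 = true → (w l).2 = true := by
    intro j l hjl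
    induction l, hjl using Nat.le_induction with
    | base => intro _ h; exact h
    | succ l hl ih =>
      intro hln hj
      obtain ⟨d, -, -, -, -, -, -, h7⟩ := hw l (by omega)
      exact h7 (ih (by omega) hj)
  have hw' : ∀ j : Fin n, NRel H (w j) (w (j + 1)) := fun j => hw j j.2
  choose d h1 h2 h3 h4 h5 h6 h7 using hw'
  refine ⟨n, ?_, d, fun j => (w j).1.1, fun j => (w j).1.2.2, fun j => (w j).1.2.1,
    h1, h3, h2, ?_, ?_, ?_, ?_, h4, ?_⟩
  · rcases Nat.eq_zero_or_pos n with h' | h'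
    · subst h'; rw [h0] at hn; simp at hn
    · exact h'
  · simp [h0, hn]
  · simp [h0, hn]
  · simp [h0]
  · simp [h0, hn]
  · intro i j hi hj
    by_contra hlt
    exact h5 j (hph (i + 1) j (by omega) (by omega) (h6 i hi)) hj

/-- A pair walk lifts to a phase-one walk. -/
lemma reach_lift {H : V → V → Prop} {p q : V × V} (h : PairReach H p q) :
    Relation.ReflTransGen (NRel H) ((p.1, p.1, p.2), true) ((q.1, q.1, q.2), true) := by
  induction h with
  | refl => exact .refl
  | tail _ h2 ih =>
    obtain ⟨d, a1, a2, a3⟩ := pairArcD_iff.1 h2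
    exact ih.tail ⟨d, a1, a1, a2, a3, fun _ => a3, fun _ => rfl, fun _ => rfl⟩

/-- Inside a strong component, avoidance is mutual. -/
lemma scc_mutual {H : V → V → Prop} (hH : ¬ CircularN H) {p q : V × V} {d : Bool}
    (h : PStep H p q d) (hr : PairReach H q p) : ¬ Step H p.2 q.1 d := by
  intro hs
  have hne : p.1 ≠ p.2 := (pairArcD_iff.2 ⟨d, h⟩).1
  refine hH (circularN_of hne (Relation.ReflTransGen.head ?_ (reach_lift hr)))
  exact ⟨d, h.1, hs, h.2.1, h.2.2, by simp, fun _ => rfl, fun _ => rfl⟩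

/-- Triple step in which the first coordinate avoids the other two. -/
def TR (H : V → V → Prop) (s t : V × V × V) : Prop :=
  ∃ d, Step H s.1 t.1 d ∧ Step H s.2.1 t.2.1 d ∧ Step H s.2.2 t.2.2 d ∧
    ¬ Step H s.1 t.2.1 d ∧ ¬ Step H s.1 t.2.2 d

lemma TR_lift {H : V → V → Prop} {s t : V × V × V} (h : Relation.ReflTransGen (TR H) s t) :
    Relation.ReflTransGen (NRel H) (s, false) (t, false) := by
  induction h with
  | refl => exact .refl
  | tail _ h2 ih =>
    obtain ⟨d, a1, a2, a3, a4, a5⟩ := h2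
    exact ih.tail ⟨d, a1, a2, a3, a5, by simp, fun h => absurd h a4, fun h => h⟩

lemma TR_reach {H : V → V → Prop} {s t : V × V × V} (h : Relation.ReflTransGen (TR H) s t) :
    PairReach H (s.1, s.2.1) (t.1, t.2.1) ∧ PairReach H (s.1, s.2.2) (t.1, t.2.2) := by
  induction h with
  | refl => exact ⟨.refl, .refl⟩
  | tail _ h2 ih =>
    obtain ⟨d, a1, a2, a3, a4, a5⟩ := h2
    exact ⟨ih.1.tail (pairArcD_iff.2 ⟨d, a1, a2, a4⟩), ih.2.tail (pairArcD_iff.2 ⟨d, a1, a3, a5⟩)⟩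

/-! Facts about `mu`. -/

lemma reach_ne {H : V → V → Prop} {p q : V × V} (h : PairReach H p q) (hp : p.1 ≠ p.2) :
    q.1 ≠ q.2 := by
  cases h with
  | refl => exact hp
  | tail _ h2 => exact h2.2.1

lemma reach_ne' {H : V → V → Prop} {p q : V × V} (h : PairReach H p q) (hq : q.1 ≠ q.2) :
    p.1 ≠ p.2 := by
  rcases Relation.ReflTransGen.cases_head h with h | ⟨c, h, -⟩
  · exact h ▸ hq
  · exact h.1

lemma mu_diag (H : V → V → Prop) (x : V) : mu H (x, x) = 0 := by
  have : ∀ m ∈ {m | CondChain H (x, x) m}, m ≤ 0 := by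
    rintro m ⟨r, h1, -, h3, -⟩
    by_contra hm
    exact reach_ne (h3 ⟨0, by omega⟩) (h1 _) rfl
  have hmem := Nat.sSup_mem (s := {m | CondChain H (x, x) m})
    ⟨0, Fin.elim0, fun i => i.elim0, fun i => i.elim0, fun i => i.elim0, fun h => by omega⟩
    ⟨0, this⟩
  exact Nat.le_zero.1 (this _ hmem)

lemma chain_snoc {H : V → V → Prop} {p q : V × V} {m : ℕ} (hpq : PairReach H p q)
    (hqp : ¬ PairReach H q p) (hq : q.1 ≠ q.2) (h : CondChain H p m) : CondChain H q (m + 1) := by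
  obtain ⟨r, h1, h2, h3, -⟩ := h
  refine ⟨Fin.snoc (α := fun _ => V × V) r q, ?_, ?_, ?_, ?_⟩
  · intro i
    refine Fin.lastCases ?_ (fun i => ?_) i
    · simpa using hq
    · simpa using h1 i
  · intro i j
    refine Fin.lastCases ?_ (fun j => ?_) j
    · refine Fin.lastCases ?_ (fun i => ?_) i
      · intro h; exact absurd h (lt_irrefl _)
      · intro _
        simp only [Fin.snoc_castSucc, Fin.snoc_last]
        exact ⟨(h3 i).trans hpq, fun h => hqp (h.trans (h3 i))⟩
    · refine Fin.lastCases ?_ (fun i => ?_) i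
      · intro h; exact absurd h (not_lt.2 (Fin.le_last _))
      · intro h
        simp only [Fin.snoc_castSucc]
        exact h2 i j (by simpa using h)
  · intro i
    refine Fin.lastCases ?_ (fun i => ?_) i
    · rw [Fin.snoc_last]; exact Relation.ReflTransGen.refl
    · rw [Fin.snoc_castSucc]; exact (h3 i).trans hpq
  · intro h
    have : (⟨m + 1 - 1, Nat.sub_lt h Nat.one_pos⟩ : Fin (m + 1)) = Fin.last m := by
      ext; simp
    rw [this, Fin.snoc_last]
    exact Relation.ReflTransGen.refl

lemma chain_scc {H : V → V → Prop} {p q : V × V} {m : ℕ} (hpq : PairReach H p q)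
    (hqp : PairReach H q p) (h : CondChain H p m) : CondChain H q m := by
  obtain ⟨r, h1, h2, h3, h4⟩ := h
  exact ⟨r, h1, h2, fun i => (h3 i).trans hpq, fun h => hqp.trans (h4 h)⟩

section Bounded

variable {H : V → V → Prop} {k : ℕ}

lemma chain_one {p : V × V} (hp : p.1 ≠ p.2) : CondChain H p 1 :=
  ⟨fun _ => p, fun _ => hp, fun i j h => by omega,
    fun _ => Relation.ReflTransGen.refl, fun _ => Relation.ReflTransGen.refl⟩

lemma mu_chain (hk1 : ∀ (p : V × V) (m : ℕ), p.1 ≠ p.2 → CondChain H p m → m ≤ k)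
    {p : V × V} (hp : p.1 ≠ p.2) : CondChain H p (mu H p) :=
  Nat.sSup_mem (s := {m | CondChain H p m}) ⟨1, chain_one hp⟩ ⟨k, fun m hm => hk1 p m hp hm⟩

lemma le_mu (hk1 : ∀ (p : V × V) (m : ℕ), p.1 ≠ p.2 → CondChain H p m → m ≤ k)
    {p : V × V} (hp : p.1 ≠ p.2) {m : ℕ} (hm : CondChain H p m) : m ≤ mu H p :=
  le_csSup ⟨k, fun m hm => hk1 p m hp hm⟩ hm

lemma mu_mono (hk1 : ∀ (p : V × V) (m : ℕ), p.1 ≠ p.2 → CondChain H p m → m ≤ k)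
    {p q : V × V} (h : PairReach H p q) : mu H p ≤ mu H q := by
  by_cases hp : p.1 = p.2
  · obtain ⟨a, b⟩ := p
    simp only at hp
    subst hp
    simp [mu_diag]
  · have hq := reach_ne h hp
    by_cases h' : PairReach H q p
    · exact le_mu hk1 hq (chain_scc h h' (mu_chain hk1 hp))
    · exact (Nat.le_succ _).trans (le_mu hk1 hq (chain_snoc h h' hq (mu_chain hk1 hp)))

lemma reach_back (hk1 : ∀ (p : V × V) (m : ℕ), p.1 ≠ p.2 → CondChain H p m → m ≤ k)
    {p q : V × V} (h : PairReach H p q) (hp : p.1 ≠ p.2) (hle : mu H q ≤ mu H p) :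
    PairReach H q p := by
  by_contra h'
  have hq := reach_ne h hp
  have := le_mu hk1 hq (chain_snoc h h' hq (mu_chain hk1 hp))
  omega

open Classical in
/-- The binary polymorphism at level `i`. -/
noncomputable def gop (H : V → V → Prop) (i : ℕ) (x y : V) : V :=
  if i ≤ mu H (x, y) then x else y

lemma gop_step (hk1 : ∀ (p : V × V) (m : ℕ), p.1 ≠ p.2 → CondChain H p m → m ≤ k)
    (i : ℕ) {x y x' y' : V} {d : Bool} (hx : Step H x x' d) (hy : Step H y y' d) :
    Step H (gop H i x y) (gop H i x' y') d := by
  unfold gop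
  split_ifs with h1 h2 h2
  · exact hx
  · by_contra hn
    exact h2 (h1.trans (mu_mono hk1 (PStep.reach (p := (x, y)) (q := (x', y')) ⟨hx, hy, hn⟩)))
  · by_contra hn
    refine h1 (h2.trans (mu_mono hk1
      (PStep.reach (p := (x', y')) (q := (x, y)) (d := !d) ⟨?_, ?_, ?_⟩)))
    · exact step_not.2 hx
    · exact step_not.2 hy
    · exact fun h => hn (step_not.1 h)
  · exact hy

/-- The first coordinate is forced at level `i`. -/
def Forced (H : V → V → Prop) (i : ℕ) (t : V × V × V) : Prop :=
  ∃ x y, i ≤ mu H (x, y) ∧ Relation.ReflTransGen (TR H) (x, y, y) t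

open Classical in
/-- The ternary operation at level `i`. -/
noncomputable def fop (H : V → V → Prop) (i : ℕ) (a b c : V) : V :=
  if Forced H i (a, b, c) then a else gop H (i + 1) (gop H i a b) c

lemma forced_step (hH : ¬ CircularN H)
    (hk1 : ∀ (p : V × V) (m : ℕ), p.1 ≠ p.2 → CondChain H p m → m ≤ k)
    {i : ℕ} (hi : 1 ≤ i) {a b c a' b' c' : V} {d : Bool}
    (ha : Step H a a' d) (hb : Step H b b' d) (hc : Step H c c' d)
    (hA : Forced H i (a, b, c)) (hA' : ¬ Forced H i (a', b', c')) :
    Step H a (gop H (i + 1) (gop H i a' b') c') d := by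
  obtain ⟨x, y, hxy, hw⟩ := hA
  have hne : x ≠ y := by
    rintro rfl
    rw [mu_diag] at hxy
    omega
  obtain ⟨hr1, hr2⟩ := TR_reach hw
  simp only at hr1 hr2
  have hab : i ≤ mu H (a, b) := hxy.trans (mu_mono hk1 hr1)
  have hac : i ≤ mu H (a, c) := hxy.trans (mu_mono hk1 hr2)
  have hor : Step H a b' d ∨ Step H a c' d := by
    by_contra hcon
    push Not at hcon
    exact hA' ⟨x, y, hxy, hw.tail ⟨d, ha, hb, hc, hcon.1, hcon.2⟩⟩
  have hm : Step H a (gop H i a' b') d := by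
    unfold gop
    split_ifs with h
    · exact ha
    · by_contra hn
      exact h (hab.trans (mu_mono hk1 (PStep.reach (p := (a, b)) (q := (a', b')) ⟨ha, hb, hn⟩)))
  rw [gop]
  split_ifs with hlev
  · exact hm
  by_contra hn
  have hab' : Step H a b' d := hor.resolve_right hn
  -- everything happens in one strong component
  have hlow : mu H (gop H i a' b', c') ≤ i := by omega
  have harc : PStep H (a, c) (gop H i a' b', c') d := ⟨hm, hc, hn⟩
  have hback : PairReach H (gop H i a' b', c') (x, y) :=
    reach_back hk1 (hr2.trans harc.reach) hne (hlow.trans hxy)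
  unfold gop at harc hback
  split_ifs at harc hback with hg
  · have hca : ¬ Step H c a' d := scc_mutual hH harc (hback.trans hr2)
    by_cases hcb : Step H c b' d
    · have harc2 : PStep H (a', b') (a, c) (!d) :=
        ⟨step_not.2 ha, step_not.2 hcb, fun h => hca (step_not.1 h)⟩
      have hle : mu H (a, c) ≤ mu H (a', b') := by
        refine le_trans ?_ hg
        refine (mu_mono hk1 harc.reach).trans ?_
        simpa [gop, hg] using hlow
      have hne2 := (pairArcD_iff.2 ⟨_, harc2⟩).1
      exact scc_mutual hH harc2 (reach_back hk1 harc2.reach hne2 hle) (step_not.2 hab')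
    · refine hH (circularN_of hne ((TR_lift hw).trans ?_))
      refine Relation.ReflTransGen.head (b := ((a', b', c'), true)) ?_ ?_
      · exact ⟨d, ha, hb, hc, hn, by simp, fun _ => rfl, fun _ => rfl⟩
      refine Relation.ReflTransGen.head (b := ((a, a, c), true)) ?_
        (reach_lift (p := (a, c)) (q := (x, y)) (harc.reach.trans hback))
      exact ⟨!d, step_not.2 ha, step_not.2 hab', step_not.2 hc, fun h => hca (step_not.1 h),
        fun _ h => hcb (step_not.1 h), fun _ => rfl, fun _ => rfl⟩
  · refine hH (circularN_of hne ((TR_lift hw).trans ?_))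
    refine Relation.ReflTransGen.head (b := ((b', b', c'), true)) ?_
      (reach_lift (p := (b', c')) (q := (x, y)) hback)
    exact ⟨d, hab', hb, hc, hn, by simp, fun _ => rfl, fun _ => rfl⟩

lemma fop_xyy (hk1 : ∀ (p : V × V) (m : ℕ), p.1 ≠ p.2 → CondChain H p m → m ≤ k)
    (i : ℕ) (x y : V) : fop H i x y y = gop H i x y := by
  unfold fop
  by_cases h : i ≤ mu H (x, y)
  · rw [if_pos ⟨x, y, h, .refl⟩]
    simp [gop, h]
  · rw [if_neg]
    · simp [gop, h]
    · rintro ⟨u, v, huv, hw⟩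
      exact h (huv.trans (mu_mono hk1 (TR_reach hw).1))

lemma fop_xxy (hk1 : ∀ (p : V × V) (m : ℕ), p.1 ≠ p.2 → CondChain H p m → m ≤ k)
    {i : ℕ} (hi : 1 ≤ i) (x y : V) : fop H i x x y = gop H (i + 1) x y := by
  unfold fop
  rw [if_neg]
  · simp [gop]
  · rintro ⟨u, v, huv, hw⟩
    have := huv.trans (mu_mono hk1 (TR_reach hw).1)
    simp only [mu_diag] at this
    omega

end Bounded

/-- no circular `N` implies an HM-chain of length `k`, the longest path
in the condensation of `H⁺`. -/
theorem statement9 (H : V → V → Prop) (hH : ¬ CircularN H) (k : ℕ)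
    (hk1 : ∀ (p : V × V) (m : ℕ), p.1 ≠ p.2 → CondChain H p m → m ≤ k)
    (hk2 : ∃ p : V × V, p.1 ≠ p.2 ∧ CondChain H p k) :
    ∃ f : ℕ → V → V → V → V, HMChain f k ∧
      ∀ i, 1 ≤ i → i ≤ k → Polymorphism3 H (f i) := by
  have hk : 1 ≤ k := by
    obtain ⟨p, hp, -⟩ := hk2
    exact hk1 p 1 hp (chain_one hp)
  refine ⟨fop H, ⟨?_, ?_, ?_⟩, ?_⟩
  · intro x y
    rw [fop_xyy hk1]
    by_cases hxy : x = y
    · subst hxy; simp [gop]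
    · have : 1 ≤ mu H (x, y) := le_mu hk1 hxy (chain_one hxy)
      simp [gop, this]
  · intro i hi _ x y
    rw [fop_xxy hk1 hi, fop_xyy hk1]
  · intro x y
    rw [fop_xxy hk1 hk]
    by_cases hxy : x = y
    · subst hxy; simp [gop]
    · have : mu H (x, y) ≤ k := hk1 (x, y) _ hxy (mu_chain hk1 hxy)
      rw [gop, if_neg (by omega)]
  · intro i hi _ a a' b b' c c' ha hb hc
    change Step H _ _ true
    have hs : Step H a a' true ∧ Step H b b' true ∧ Step H c c' true := ⟨ha, hb, hc⟩
    by_cases h1 : Forced H i (a, b, c) <;> by_cases h2 : Forced H i (a', b', c')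
    · simp only [fop, if_pos h1, if_pos h2]; exact ha
    · simp only [fop, if_pos h1, if_neg h2]
      exact forced_step hH hk1 hi hs.1 hs.2.1 hs.2.2 h1 h2
    · simp only [fop, if_neg h1, if_pos h2]
      refine step_not.1 (forced_step hH hk1 hi (d := !true) ?_ ?_ ?_ h2 h1)
      · exact step_not.2 hs.1
      · exact step_not.2 hs.2.1
      · exact step_not.2 hs.2.2
    · simp only [fop, if_neg h1, if_neg h2]
      exact gop_step hk1 _ (gop_step hk1 _ hs.1 hs.2.1) hs.2.2

end DigraphListHom
end
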